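/- Let α ∈ (0,1), λ ≥ 0, and define u : (0,∞) → ℝ by u(s) = E_α(−λ s^α) = ∑_{j=0}^∞ (−λ s^α)^j / Γ(αj + 1). Then for every t > 0, (1/Γ(1−α)) ∫₀^t u′(s) · (t−s)^{−α} ds = −λ · E_α(−λ t^α), i.e. the Mittag-Leffler function t ↦ E_α(−λ t^α) is an eigenfunction of the Caputo–Djrbashian fractional derivative of order α with eigenvalue −λ. -/

import Mathlib

open MeasureTheory Real Set

/-- The Mittag-Leffler function E_α(z) = ∑_{j≥0} z^j / Γ(αj+1). -/
noncomputable def mittagLeffler (α z : ℝ) : ℝ :=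
  ∑' j : ℕ, z ^ j / Real.Gamma (α * j + 1)

theorem exp_neg_mul_rpow_le_Gamma_add_one {M x : ℝ} (hM : 0 < M) (hx : 0 ≤ x) :
    Real.exp (-M) * M ^ x ≤ Real.Gamma (x + 1) := by
  have hint : IntegrableOn (fun y : ℝ => Real.exp (-y) * y ^ (x + 1 - 1)) (Ioi 0) :=
    Real.GammaIntegral_convergent (by linarith)
  have hsub : Ioi M ⊆ Ioi (0 : ℝ) := Ioi_subset_Ioi hM.le
  rw [Real.Gamma_eq_integral (by linarith), ← integral_exp_neg_Ioi M, ← integral_mul_const]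
  calc ∫ y in Ioi M, Real.exp (-y) * M ^ x
      ≤ ∫ y in Ioi M, Real.exp (-y) * y ^ (x + 1 - 1) := by
        refine setIntegral_mono_on ((integrableOn_exp_neg_Ioi M).mul_const _)
          (hint.mono_set hsub) measurableSet_Ioi fun y hy => ?_
        rw [add_sub_cancel_right]
        have hy' : M ≤ y := le_of_lt hy
        gcongr
    _ ≤ ∫ y in Ioi 0, Real.exp (-y) * y ^ (x + 1 - 1) := by
        refine setIntegral_mono_set hint ?_ hsub.eventuallyLE
        filter_upwards [ae_restrict_mem measurableSet_Ioi] with y hy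
        have : 0 < y := hy
        simp only [Pi.zero_apply]
        positivity

theorem summable_pow_div_Gamma {α : ℝ} (hα : 0 < α) (z : ℝ) :
    Summable fun j : ℕ => z ^ j / Real.Gamma (α * j + 1) := by
  set A : ℝ := 2 * (|z| + 1) with hA
  have hA0 : 0 < A := by positivity
  have hM : 0 < A ^ α⁻¹ := Real.rpow_pos_of_pos hA0 _
  refine Summable.of_norm_bounded (g := fun j : ℕ => Real.exp (A ^ α⁻¹) * (1 / 2 : ℝ) ^ j)
    ((summable_geometric_of_lt_one (by norm_num) (by norm_num)).mul_left _) fun j => ?_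
  have hG := exp_neg_mul_rpow_le_Gamma_add_one hM (x := α * j) (by positivity)
  have hpow : (A ^ α⁻¹) ^ (α * j) = A ^ j := by
    rw [← Real.rpow_mul hA0.le, ← mul_assoc, inv_mul_cancel₀ hα.ne', one_mul, Real.rpow_natCast]
  rw [hpow] at hG
  have hGpos : 0 < Real.Gamma (α * j + 1) := Real.Gamma_pos_of_pos (by positivity)
  rw [norm_div, norm_pow, Real.norm_eq_abs, Real.norm_of_nonneg hGpos.le, div_le_iff₀ hGpos]
  calc |z| ^ j ≤ (A / 2) ^ j := by gcongr; rw [hA]; linarith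
    _ = Real.exp (A ^ α⁻¹) * (1 / 2) ^ j * (Real.exp (-A ^ α⁻¹) * A ^ j) := by
        rw [Real.exp_neg, div_pow, div_pow]
        field_simp
        simp
    _ ≤ _ := by gcongr

/-- The Euler beta integral over `[0, t]`. -/
theorem integral_rpow_mul_sub_rpow {b c t : ℝ} (hb : 0 < b) (hc : 0 < c) (ht : 0 < t) :
    ∫ s in (0 : ℝ)..t, s ^ (b - 1) * (t - s) ^ (c - 1) =
      t ^ (b + c - 1) * (Real.Gamma b * Real.Gamma c / Real.Gamma (b + c)) := by
  have h := Complex.betaIntegral_scaled b c ht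
  rw [Complex.betaIntegral_eq_Gamma_mul_div _ _ (by simpa) (by simpa)] at h
  rw [← Complex.ofReal_inj, ← intervalIntegral.integral_ofReal]
  convert h using 1
  · refine intervalIntegral.integral_congr fun s hs => ?_
    rw [uIcc_of_le ht.le] at hs
    rw [Complex.ofReal_mul, Complex.ofReal_cpow hs.1, Complex.ofReal_cpow (sub_nonneg.2 hs.2)]
    push_cast
    rfl
  · rw [Complex.ofReal_mul, Complex.ofReal_cpow ht.le]
    push_cast [← Complex.Gamma_ofReal]
    rfl

theorem intervalIntegrable_rpow_mul_sub_rpow {b c t : ℝ} (hb : 0 < b) (hc : 0 < c)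
    (ht : 0 < t) :
    IntervalIntegrable (fun s : ℝ => s ^ (b - 1) * (t - s) ^ (c - 1)) volume 0 t := by
  refine not_imp_comm.1 intervalIntegral.integral_undef ?_
  rw [integral_rpow_mul_sub_rpow hb hc ht]
  have := Real.Gamma_pos_of_pos hb
  have := Real.Gamma_pos_of_pos hc
  have := Real.Gamma_pos_of_pos (add_pos hb hc)
  positivity

theorem norm_mul_pow_pred_div_Gamma_le {α R y : ℝ} (hα : 0 < α) (hR : 1 ≤ R) (hy : |y| ≤ R)
    (j : ℕ) :
    ‖j * y ^ (j - 1) / Real.Gamma (α * j + 1)‖ ≤ (2 * R) ^ j / Real.Gamma (α * j + 1) := by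
  have hG : 0 < Real.Gamma (α * j + 1) := Real.Gamma_pos_of_pos (by positivity)
  rw [norm_div, Real.norm_of_nonneg hG.le]
  gcongr
  rw [norm_mul, norm_pow, Real.norm_natCast, Real.norm_eq_abs, mul_pow]
  gcongr
  · exact_mod_cast Nat.lt_two_pow_self.le
  · calc |y| ^ (j - 1) ≤ R ^ (j - 1) := by gcongr
      _ ≤ R ^ j := pow_le_pow_right₀ hR (Nat.sub_le _ _)

theorem summable_mul_pow_pred_div_Gamma {α : ℝ} (hα : 0 < α) (z : ℝ) :
    Summable fun j : ℕ => j * z ^ (j - 1) / Real.Gamma (α * j + 1) :=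
  (summable_pow_div_Gamma hα _).of_norm_bounded
    (norm_mul_pow_pred_div_Gamma_le hα (R := |z| + 1) (by simp) (by simp))

theorem hasDerivAt_mittagLeffler {α : ℝ} (hα : 0 < α) (z : ℝ) :
    HasDerivAt (mittagLeffler α)
      (∑' j : ℕ, j * z ^ (j - 1) / Real.Gamma (α * j + 1)) z := by
  have hz : z ∈ Metric.ball 0 (|z| + 1) := by simp
  refine hasDerivAt_tsum_of_isPreconnected
    (g := fun (j : ℕ) z => z ^ j / Real.Gamma (α * j + 1))
    (summable_pow_div_Gamma hα (2 * (|z| + 1))) Metric.isOpen_ball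
    (convex_ball 0 (|z| + 1)).isPreconnected
    (fun j y _ => (hasDerivAt_pow j y).div_const _) (fun j y hy => ?_) hz
    (summable_pow_div_Gamma hα _) hz
  exact norm_mul_pow_pred_div_Gamma_le hα (by simp) (mem_ball_zero_iff.1 hy).le j

theorem hasSum_deriv_mittagLeffler_mul_rpow {α : ℝ} (hα : 0 < α) (c : ℝ) {s : ℝ} (hs : 0 < s) :
    HasSum (fun j : ℕ => c ^ (j + 1) / Real.Gamma (α * (j + 1)) * s ^ (α * (j + 1) - 1))
      (deriv (fun r : ℝ => mittagLeffler α (c * r ^ α)) s) := by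
  have hder := (hasDerivAt_mittagLeffler hα (c * s ^ α)).comp s
    ((Real.hasDerivAt_rpow_const (p := α) (Or.inl hs.ne')).const_mul c)
  rw [show deriv (fun r : ℝ => mittagLeffler α (c * r ^ α)) s = _ from hder.deriv]
  have hsum := ((hasSum_nat_add_iff' 1).2
    (summable_mul_pow_pred_div_Gamma hα (c * s ^ α)).hasSum).mul_right (c * (α * s ^ (α - 1)))
  simp only [Finset.sum_range_one, Nat.cast_zero, zero_mul, zero_div, sub_zero,
    Nat.add_sub_cancel, Nat.cast_add, Nat.cast_one] at hsum
  refine hsum.congr_fun fun j => ?_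
  have hb : 0 < α * (j + 1) := by positivity
  have := (Real.Gamma_pos_of_pos hb).ne'
  rw [Real.Gamma_add_one hb.ne', show α * (j + 1) - 1 = α * j + (α - 1) by ring,
    Real.rpow_add hs, Real.rpow_mul_natCast hs.le]
  field_simp
  ring

/-- The Caputo integral of `t ↦ E_α(c t^α)` for a coefficient `c` of arbitrary sign. -/
theorem integral_deriv_mittagLeffler_mul_sub_rpow {α : ℝ} (hα : 0 < α) (hα1 : α < 1) (c : ℝ)
    {t : ℝ} (ht : 0 < t) :
    ∫ s in (0 : ℝ)..t, deriv (fun r : ℝ => mittagLeffler α (c * r ^ α)) s * (t - s) ^ (-α) =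
      Real.Gamma (1 - α) * (c * mittagLeffler α (c * t ^ α)) := by
  set F : ℕ → ℝ → ℝ := fun j s => c ^ (j + 1) / Real.Gamma (α * (j + 1)) *
    (s ^ (α * (j + 1) - 1) * (t - s) ^ (1 - α - 1)) with hF
  have hb (j : ℕ) : 0 < α * (j + 1) := by positivity
  have hc : 0 < 1 - α := sub_pos.2 hα1
  have hint (j : ℕ) : Integrable (F j) (volume.restrict (Ioc 0 t)) :=
    ((intervalIntegrable_iff_integrableOn_Ioc_of_le ht.le).1
      (intervalIntegrable_rpow_mul_sub_rpow (hb j) hc ht)).const_mul _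
  have hbeta (a : ℝ) (j : ℕ) : ∫ s in Ioc 0 t, a ^ (j + 1) / Real.Gamma (α * (j + 1)) *
      (s ^ (α * (j + 1) - 1) * (t - s) ^ (1 - α - 1)) =
      Real.Gamma (1 - α) * (a * ((a * t ^ α) ^ j / Real.Gamma (α * j + 1))) := by
    rw [integral_const_mul, ← intervalIntegral.integral_of_le ht.le,
      integral_rpow_mul_sub_rpow (hb j) hc ht]
    have := (Real.Gamma_pos_of_pos (hb j)).ne'
    rw [show α * (j + 1) + (1 - α) - 1 = α * j by ring,
      show α * (j + 1) + (1 - α) = α * j + 1 by ring, Real.rpow_mul_natCast ht.le]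
    field_simp
    ring
  have hnorm (j : ℕ) : ∫ s in Ioc 0 t, ‖F j s‖ =
      Real.Gamma (1 - α) * (|c| * ((|c| * t ^ α) ^ j / Real.Gamma (α * j + 1))) := by
    rw [← hbeta]
    refine setIntegral_congr_fun measurableSet_Ioc fun s hs => ?_
    have h1 : 0 ≤ s ^ (α * (j + 1) - 1) := Real.rpow_nonneg hs.1.le _
    have h2 : 0 ≤ (t - s) ^ (1 - α - 1) := Real.rpow_nonneg (sub_nonneg.2 hs.2) _
    simp only [hF, norm_mul, norm_div, norm_pow, Real.norm_of_nonneg h1, Real.norm_of_nonneg h2,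
      Real.norm_of_nonneg (Real.Gamma_pos_of_pos (hb j)).le, Real.norm_eq_abs]
  have hsum := hasSum_integral_of_summable_integral_norm hint <| by
    simp_rw [hnorm]
    exact ((summable_pow_div_Gamma hα _).mul_left _).mul_left _
  simp_rw [hF, hbeta] at hsum
  have hser := (((summable_pow_div_Gamma hα (c * t ^ α)).hasSum.mul_left c).mul_left
    (Real.Gamma (1 - α)))
  rw [mittagLeffler, ← hsum.unique hser, intervalIntegral.integral_of_le ht.le]
  refine setIntegral_congr_fun measurableSet_Ioc fun s hs => ?_
  have h := (hasSum_deriv_mittagLeffler_mul_rpow hα c hs.1).mul_right ((t - s) ^ (-α))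
  simp only [sub_sub_cancel_left, ← mul_assoc, h.tsum_eq]

/-- The Mittag-Leffler function t ↦ E_α(-λ t^α) is an eigenfunction of the
Caputo–Djrbashian fractional derivative of order α with eigenvalue -λ:
for u(s) = E_α(-λ s^α) and t > 0,
(1/Γ(1-α)) ∫₀^t u'(s) (t-s)^{-α} ds = -λ E_α(-λ t^α). -/
theorem mittagLeffler_eigenfunction_caputo
    (α : ℝ) (hα : α ∈ Set.Ioo (0 : ℝ) 1) (lam : ℝ) (hlam : 0 ≤ lam)
    (t : ℝ) (ht : 0 < t) :
    (1 / Real.Gamma (1 - α)) *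
        ∫ s in (0 : ℝ)..t,
          deriv (fun r : ℝ => mittagLeffler α (-lam * r ^ α)) s * (t - s) ^ (-α)
      = -lam * mittagLeffler α (-lam * t ^ α) := by
  rw [integral_deriv_mittagLeffler_mul_sub_rpow hα.1 hα.2 _ ht, ← mul_assoc, one_div,
    inv_mul_cancel₀ (Real.Gamma_pos_of_pos (sub_pos.2 hα.2)).ne', one_mul]
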